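/- Let G be a finite nilpotent group. Then for every positive integer n, rank(G^n) = n·rank(G). -/

import Mathlib

/-- Minimal length of a word in elements of `X` (no inverses) expressing `g`;
`0` if no such word exists (by `sInf` of empty set). -/
noncomputable def wordLen {G : Type*} [Group G] (X : Set G) (g : G) : ℕ :=
  sInf {n | ∃ w : List G, (∀ x ∈ w, x ∈ X) ∧ w.length = n ∧ w.prod = g}

/-- Minimal length of a word in elements of `X ∪ X⁻¹` expressing `g`. -/
noncomputable def symWordLen {G : Type*} [Group G] (X : Set G) (g : G) : ℕ :=
  wordLen (X ∪ X⁻¹) g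

/-- The (non-symmetric) diameter of `G` with respect to `X`. -/
noncomputable def diam (G : Type*) [Group G] (X : Set G) : ℕ :=
  sSup (Set.range (wordLen X))

/-- The symmetric diameter of `G` with respect to `X`. -/
noncomputable def symDiam (G : Type*) [Group G] (X : Set G) : ℕ :=
  sSup (Set.range (symWordLen X))

/-- `D(G)`: maximum of `diam` over all generating sets. -/
noncomputable def maxDiam (G : Type*) [Group G] : ℕ :=
  sSup {d | ∃ X : Set G, Subgroup.closure X = ⊤ ∧ diam G X = d}

/-- `D^s(G)`: maximum of `symDiam` over all generating sets. -/
noncomputable def maxSymDiam (G : Type*) [Group G] : ℕ :=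
  sSup {d | ∃ X : Set G, Subgroup.closure X = ⊤ ∧ symDiam G X = d}

/-- `rank(G)`: minimal cardinality of a generating set. -/
noncomputable def grpRank (G : Type*) [Group G] : ℕ :=
  sInf {n | ∃ S : Finset G, S.card = n ∧ Subgroup.closure (S : Set G) = ⊤}

/-- `T` is a right transversal for `G` mod `H`: it meets every right coset `Hg`
in exactly one element. -/
def IsRightTransversal {G : Type*} [Group G] (H : Subgroup G) (T : Set G) : Prop :=
  ∀ g : G, ∃! t, t ∈ T ∧ g * t⁻¹ ∈ H

instance piNormal {ι : Type*} {G : Type*} [Group G] (H : Subgroup G) [hH : H.Normal] :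
    (Subgroup.pi Set.univ fun _ : ι => H).Normal := by
  constructor
  intro m hm g i hi
  exact hH.conj_mem _ (hm i trivial) (g i)


/-- The `F_p`-space of homomorphisms `G → ZMod p`. -/
abbrev HomSp (G : Type*) [Group G] (p : ℕ) := Additive G →+ ZMod p

lemma homSp_finite (G : Type*) [Group G] [Finite G] (p : ℕ) [Fact p.Prime] :
    Module.Finite (ZMod p) (HomSp G p) := by
  have : Finite (Additive G) := ‹Finite G›
  have : Finite (HomSp G p) := DFunLike.finite _
  exact Module.Finite.of_finite

lemma homSp_ext {G : Type*} [Group G] {p : ℕ} {S : Set G} (hS : Subgroup.closure S = ⊤)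
    (f : HomSp G p) (h : ∀ x ∈ S, f (Additive.ofMul x) = 0) : f = 0 := by
  have key : ∀ g : G, f (Additive.ofMul g) = 0 := by
    intro g
    have hg : g ∈ Subgroup.closure S := by rw [hS]; trivial
    induction hg using Subgroup.closure_induction with
    | mem x hx => exact h x hx
    | one => simp
    | mul x y _ _ hx hy => simp [hx, hy]
    | inv x _ hx => simp [hx]
  exact AddMonoidHom.ext fun g => key g.toMul

lemma finrank_homSp_le {G : Type*} [Group G] (p : ℕ) [Fact p.Prime] (S : Finset G)
    (hS : Subgroup.closure (S : Set G) = ⊤) :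
    Module.finrank (ZMod p) (HomSp G p) ≤ S.card := by
  let L : HomSp G p →ₗ[ZMod p] (S → ZMod p) :=
    { toFun := fun f s => f (Additive.ofMul s.1)
      map_add' := fun f g => rfl
      map_smul' := fun c f => rfl }
  have hL : Function.Injective L := by
    rw [injective_iff_map_eq_zero]
    intro f hf
    refine homSp_ext hS f fun x hx => ?_
    exact congrFun hf ⟨x, hx⟩
  have := LinearMap.finrank_le_finrank_of_injective hL
  simpa using this

lemma mul_finrank_homSp_le (G : Type*) [Group G] [Finite G] (p n : ℕ) [Fact p.Prime] :
    n * Module.finrank (ZMod p) (HomSp G p) ≤ Module.finrank (ZMod p) (HomSp (Fin n → G) p) := by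
  have := homSp_finite G p
  have := homSp_finite (Fin n → G) p
  let L : (Fin n → HomSp G p) →ₗ[ZMod p] HomSp (Fin n → G) p :=
    { toFun := fun φ =>
        { toFun := fun g => ∑ i, φ i (Additive.ofMul (g.toMul i))
          map_zero' := by simp
          map_add' := fun a b => by simp [Finset.sum_add_distrib] }
      map_add' := fun f g => by ext x; simp [Finset.sum_add_distrib]
      map_smul' := fun c f => by ext x; simp [Finset.mul_sum] }
  have hL : Function.Injective L := by
    rw [injective_iff_map_eq_zero]
    intro φ hφ
    funext i
    refine AddMonoidHom.ext fun x => ?_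
    have h := DFunLike.congr_fun hφ (Additive.ofMul (Pi.mulSingle i x.toMul : Fin n → G))
    change ∑ j, φ j (Additive.ofMul ((Pi.mulSingle i x.toMul : Fin n → G) j)) = 0 at h
    rw [Finset.sum_eq_single i] at h
    · simpa using h
    · intro j _ hj
      simp [Pi.mulSingle_eq_of_ne hj]
    · simp
  have := LinearMap.finrank_le_finrank_of_injective hL
  simpa [Module.finrank_pi_fintype] using this

lemma exists_separating (G : Type*) [Group G] [Finite G] (p : ℕ) [Fact p.Prime] (d : ℕ)
    (hd : Module.finrank (ZMod p) (HomSp G p) ≤ d) :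
    ∃ g : Fin d → G, ∀ f : HomSp G p, (∀ i, f (Additive.ofMul (g i)) = 0) → f = 0 := by
  classical
  have := homSp_finite G p
  let ev : G → Module.Dual (ZMod p) (HomSp G p) := fun x =>
    { toFun := fun f => f (Additive.ofMul x)
      map_add' := fun f g => rfl
      map_smul' := fun c f => rfl }
  obtain ⟨b, hb, hspan, hli⟩ := exists_linearIndependent (ZMod p) (Set.range ev)
  have hbf : b.Finite := (Set.finite_range ev).subset hb
  have := hbf.fintype
  have hcard : b.toFinset.card ≤ d := by
    have := hli.fintype_card_le_finrank
    rw [Subspace.dual_finrank_eq] at this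
    rw [Set.toFinset_card]
    exact this.trans hd
  choose c hc using fun x : b => hb x.2
  let T : Finset G := Finset.univ.image c
  have hT : T.card ≤ d := by
    refine Finset.card_image_le.trans ?_
    rw [Finset.card_univ, ← Set.toFinset_card]
    exact hcard
  refine ⟨fun i => T.toList.getD i 1, fun f hf => ?_⟩
  have h1 : ∀ x ∈ T, f (Additive.ofMul x) = 0 := by
    intro x hx
    obtain ⟨k, hk, rfl⟩ := List.getElem_of_mem (Finset.mem_toList.2 hx)
    have hk' : k < d := by
      rw [Finset.length_toList] at hk
      omega
    have h := hf ⟨k, hk'⟩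
    beta_reduce at h
    rw [List.getD_eq_getElem _ _ hk] at h
    exact h
  have h2 : b ⊆ (LinearMap.ker (Module.Dual.eval (ZMod p) (HomSp G p) f) : Set _) := by
    intro φ hφ
    have := h1 (c ⟨φ, hφ⟩) (Finset.mem_image_of_mem _ (Finset.mem_univ _))
    have h3 := hc ⟨φ, hφ⟩
    simp only at h3
    rw [SetLike.mem_coe, LinearMap.mem_ker, Module.Dual.eval_apply, ← h3]
    exact this
  have h4 := Submodule.span_le.2 h2
  rw [hspan, Submodule.span_le] at h4
  refine AddMonoidHom.ext fun x => ?_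
  have := h4 ⟨x.toMul, rfl⟩
  rw [SetLike.mem_coe, LinearMap.mem_ker, Module.Dual.eval_apply] at this
  exact this

lemma exists_hom_of_ne_top {G : Type*} [Group G] [Finite G] [Group.IsNilpotent G]
    (H : Subgroup G) (hH : H ≠ ⊤) :
    ∃ p : ℕ, p.Prime ∧ p ∣ Nat.card G ∧
      ∃ f : HomSp G p, f ≠ 0 ∧ ∀ x ∈ H, f (Additive.ofMul x) = 0 := by
  obtain ⟨M, hM, hHM⟩ := (eq_top_or_exists_le_coatom H).resolve_left hH
  have hN : M.Normal := Subgroup.NormalizerCondition.normal_of_coatom _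
    Group.normalizerCondition_of_isNilpotent hM
  have : Nontrivial (G ⧸ M) := QuotientGroup.nontrivial_iff.2 hM.1
  have hsurj := QuotientGroup.mk'_surjective M
  have : IsSimpleGroup (G ⧸ M) := by
    constructor
    intro K hK
    have hle : M ≤ K.comap (QuotientGroup.mk' M) := by
      intro x hx
      rw [Subgroup.mem_comap]
      have : QuotientGroup.mk' M x = 1 := (QuotientGroup.eq_one_iff x).2 hx
      rw [this]
      exact K.one_mem
    rcases hM.le_iff.1 hle with h | h
    · right
      rw [← Subgroup.map_comap_eq_self_of_surjective hsurj K, h,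
        Subgroup.map_top_of_surjective _ hsurj]
    · left
      rw [← Subgroup.map_comap_eq_self_of_surjective hsurj K, h]
      exact QuotientGroup.map_mk'_self M
  let : CommGroup (G ⧸ M) :=
    { (inferInstance : Group (G ⧸ M)) with
      mul_comm := IsSimpleGroup.comm_iff_isSolvable.2 inferInstance }
  obtain ⟨p, hp, ⟨e⟩⟩ := exists_prime_addEquiv_ZMod (G := G ⧸ M)
  refine ⟨p, hp, ?_, e.toAddMonoidHom.comp (QuotientGroup.mk' M).toAdditive, ?_, ?_⟩
  · have h1 : Nat.card (G ⧸ M) = p := by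
      have := Nat.card_congr e.toEquiv
      rw [Nat.card_zmod] at this
      exact this
    rw [← h1]
    exact Subgroup.card_quotient_dvd_card M
  · intro h0
    obtain ⟨y, hy⟩ := exists_ne (1 : G ⧸ M)
    obtain ⟨x, rfl⟩ := hsurj y
    apply hy
    have := DFunLike.congr_fun h0 (Additive.ofMul x)
    change e (Additive.ofMul (QuotientGroup.mk' M x)) = 0 at this
    rw [map_eq_zero_iff e e.injective] at this
    exact this
  · intro x hx
    have : QuotientGroup.mk' M x = 1 := (QuotientGroup.eq_one_iff x).2 (hHM hx)
    change e (Additive.ofMul (QuotientGroup.mk' M x)) = 0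
    rw [this]
    simp

lemma grpRank_le {G : Type*} [Group G] (S : Finset G)
    (hS : Subgroup.closure (S : Set G) = ⊤) : grpRank G ≤ S.card :=
  Nat.sInf_le ⟨S, rfl, hS⟩

lemma grpRank_spec (G : Type*) [Group G] [Finite G] :
    ∃ S : Finset G, S.card = grpRank G ∧ Subgroup.closure (S : Set G) = ⊤ := by
  have := Fintype.ofFinite G
  exact Nat.sInf_mem (s := {n | ∃ S : Finset G, S.card = n ∧ Subgroup.closure (S : Set G) = ⊤})
    ⟨_, Finset.univ, rfl, by simp⟩

lemma hom_list_prod {G : Type*} [Group G] {p : ℕ} (f : HomSp G p) {α : Type*} (l : List α)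
    (h : α → G) : f (Additive.ofMul (l.map h).prod) =
      (l.map fun q => f (Additive.ofMul (h q))).sum := by
  induction l with
  | nil => simp
  | cons a l ih => rw [List.map_cons, List.prod_cons, ofMul_mul, map_add, ih, List.map_cons, List.sum_cons]

lemma grpRank_le_of_finrank {G : Type*} [Group G] [Finite G] [Group.IsNilpotent G] (d : ℕ)
    (hd : ∀ p : ℕ, p.Prime → Module.finrank (ZMod p) (HomSp G p) ≤ d) : grpRank G ≤ d := by
  classical
  have hex : ∀ p : ℕ, ∃ g : Fin d → G, p.Prime →
      ∀ f : HomSp G p, (∀ i, f (Additive.ofMul (g i)) = 0) → f = 0 := by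
    intro p
    by_cases hp : p.Prime
    · have := Fact.mk hp
      obtain ⟨g, hg⟩ := exists_separating G p d (hd p hp)
      exact ⟨g, fun _ => hg⟩
    · exact ⟨fun _ => 1, fun h => absurd h hp⟩
  choose g hg using hex
  let P := (Nat.card G).primeFactors
  let e : ℕ → ℕ := fun q => ∏ r ∈ P.erase q, r
  let t : Fin d → G := fun i => (P.toList.map fun q => g q i ^ e q).prod
  have hcl : Subgroup.closure ((Finset.univ.image t : Finset G) : Set G) = ⊤ := by
    by_contra hne
    obtain ⟨p, hp, hpd, f, hf0, hf⟩ := exists_hom_of_ne_top _ hne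
    have := Fact.mk hp
    have hpP : p ∈ P := Nat.mem_primeFactors.2 ⟨hp, hpd, Nat.card_pos.ne'⟩
    apply hf0
    apply hg p hp f
    intro i
    have h1 : f (Additive.ofMul (t i)) = 0 := by
      apply hf
      apply Subgroup.subset_closure
      simp
    have h2 : f (Additive.ofMul (t i)) = ∑ q ∈ P, (e q : ZMod p) * f (Additive.ofMul (g q i)) := by
      rw [hom_list_prod, Finset.sum_map_toList]
      simp
    rw [h2, Finset.sum_eq_single p] at h1
    · rcases mul_eq_zero.1 h1 with h | h
      · exfalso
        rw [ZMod.natCast_eq_zero_iff, hp.prime.dvd_finsetProd_iff] at h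
        obtain ⟨r, hr, hpr⟩ := h
        rw [Finset.mem_erase] at hr
        exact hr.1 ((Nat.prime_dvd_prime_iff_eq hp (Nat.prime_of_mem_primeFactors hr.2)).1 hpr).symm
      · exact h
    · intro q _ hqp
      have : (e q : ZMod p) = 0 := by
        rw [ZMod.natCast_eq_zero_iff]
        exact Finset.dvd_prod_of_mem _ (Finset.mem_erase.2 ⟨hqp.symm, hpP⟩)
      rw [this, zero_mul]
    · exact fun h => absurd hpP h
  refine (grpRank_le _ hcl).trans (Finset.card_image_le.trans ?_)
  simp

lemma grpRank_pi_le (G : Type*) [Group G] [Finite G] (n : ℕ) :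
    grpRank (Fin n → G) ≤ n * grpRank G := by
  classical
  obtain ⟨S, hSc, hS⟩ := grpRank_spec G
  let T : Finset (Fin n → G) :=
    Finset.univ.image fun x : Fin n × S => (Pi.mulSingle x.1 x.2.1 : Fin n → G)
  have hT : Subgroup.closure (T : Set (Fin n → G)) = ⊤ := by
    rw [eq_top_iff]
    intro x _
    apply Subgroup.pi_mem_of_mulSingle_mem
    intro i
    have hle : Subgroup.closure (S : Set G) ≤
        (Subgroup.closure (T : Set (Fin n → G))).comap (MonoidHom.mulSingle (fun _ => G) i) := by
      rw [Subgroup.closure_le]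
      intro s hs
      apply Subgroup.subset_closure
      exact Finset.mem_coe.2 (Finset.mem_image.2 ⟨(i, ⟨s, hs⟩), Finset.mem_univ _, rfl⟩)
    rw [hS] at hle
    exact hle (Subgroup.mem_top (x i))
  refine (grpRank_le T hT).trans (Finset.card_image_le.trans ?_)
  simp [hSc]

theorem stmt6 {G : Type*} [Group G] [Finite G] [Group.IsNilpotent G] (n : ℕ) (hn : 0 < n) :
    grpRank (Fin n → G) = n * grpRank G := by
  refine le_antisymm (grpRank_pi_le G n) ?_
  obtain ⟨S, hSc, hS⟩ := grpRank_spec (Fin n → G)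
  have h : grpRank G ≤ S.card / n := by
    apply grpRank_le_of_finrank
    intro p hp
    have := Fact.mk hp
    rw [Nat.le_div_iff_mul_le hn, mul_comm]
    exact (mul_finrank_homSp_le G p n).trans (finrank_homSp_le p S hS)
  rw [Nat.le_div_iff_mul_le hn, mul_comm] at h
  rw [← hSc]
  exact h
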